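/- Let A₀ be Metzler and A_{n,i}, and A_{n,i}A₀ + A_{r,i} be nonnegative for i = 1,…,N. Then the block Metzler matrix [[A₀, [I_n … I_n]], [col(A_{n,i}A₀ + A_{r,i}), col(𝟙_Nᵀ ⊗ A_{n,i}) − I_{Nn}]] is Hurwitz stable if and only if ρ(Σᵢ A_{n,i}) < 1 and the Metzler matrix (I_n − Σᵢ A_{n,i})^{-1}(A₀ + Σᵢ A_{r,i}) is Hurwitz stable. -/

import Mathlib

open Matrix

def IsMetzler {m : Type*} [DecidableEq m] (A : Matrix m m ℝ) : Prop :=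
  ∀ i j, i ≠ j → 0 ≤ A i j

def IsHurwitz {m : Type*} [Fintype m] [DecidableEq m] (A : Matrix m m ℝ) : Prop :=
  ∀ μ ∈ spectrum ℂ (A.map (fun x => (x : ℂ))), μ.re < 0

noncomputable def specRad {m : Type*} [Fintype m] [DecidableEq m] (M : Matrix m m ℝ) : ℝ :=
  (spectralRadius ℂ (M.map (fun x => (x : ℂ)))).toReal

/-- `col(𝟙_Nᵀ ⊗ A_{n,i})` : the `Nn×Nn` matrix whose `(i,j)` block is `A i`. -/
def blockRowRep {n N : ℕ} (A : Fin N → Matrix (Fin n) (Fin n) ℝ) :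
    Matrix (Fin N × Fin n) (Fin N × Fin n) ℝ :=
  Matrix.of fun ik jl => A ik.1 ik.2 jl.2

/-- Vertical stacking of matrices `M i`. -/
def colStack {n N : ℕ} (M : Fin N → Matrix (Fin n) (Fin n) ℝ) :
    Matrix (Fin N × Fin n) (Fin n) ℝ :=
  Matrix.of fun ik j => M ik.1 ik.2 j

/-- `[I_n … I_n]` : the horizontal concatenation of N identity matrices. -/
def rowOnes {n N : ℕ} : Matrix (Fin n) (Fin N × Fin n) ℝ :=
  Matrix.of fun i jl => if i = jl.2 then 1 else 0


lemma aux_mem_spectrum {m : Type*} [Fintype m] [DecidableEq m] (A : Matrix m m ℂ) (μ : ℂ) :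
    μ ∈ spectrum ℂ A ↔ ∃ z : m → ℂ, z ≠ 0 ∧ A *ᵥ z = μ • z := by
  rw [spectrum.mem_iff, Matrix.isUnit_iff_isUnit_det, isUnit_iff_ne_zero, not_not,
    ← Matrix.exists_mulVec_eq_zero_iff]
  refine exists_congr fun z => and_congr_right fun _ => ?_
  rw [Matrix.sub_mulVec, sub_eq_zero, Algebra.algebraMap_eq_smul_one, Matrix.smul_mulVec,
    Matrix.one_mulVec, eq_comm]

lemma aux_eig {m : Type*} [Fintype m] [DecidableEq m] (M : Matrix m m ℝ) (hM : IsMetzler M)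
    (v : m → ℝ) (hv : ∀ i, 0 < v i) (t : ℝ) (ht : ∀ i, (M *ᵥ v) i < t * v i)
    (μ : ℂ) (hμ : μ ∈ spectrum ℂ (M.map (fun x => (x : ℂ)))) :
    ∃ i, ‖μ - M i i‖ < t - M i i := by
  obtain ⟨z, hz, he⟩ := (aux_mem_spectrum _ _).1 hμ
  obtain ⟨k, hk⟩ : ∃ k, z k ≠ 0 := by
    by_contra! h
    exact hz (funext h)
  obtain ⟨i, -, hi⟩ := Finset.exists_max_image Finset.univ (fun i => ‖z i‖ / v i) ⟨k, Finset.mem_univ _⟩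
  refine ⟨i, ?_⟩
  set c := ‖z i‖ / v i with hc
  have hle : ∀ j, ‖z j‖ ≤ c * v j := fun j => (div_le_iff₀ (hv j)).1 (hi j (Finset.mem_univ _))
  have hcpos : 0 < c := lt_of_lt_of_le (div_pos (norm_pos_iff.2 hk) (hv k)) (hi k (Finset.mem_univ _))
  have hzi : ‖z i‖ = c * v i := by rw [hc]; field_simp [(hv i).ne']
  have h1 : (μ - M i i) * z i = ∑ j ∈ Finset.univ.erase i, (M i j : ℂ) * z j := by
    have := congrFun he i
    simp only [Matrix.mulVec, dotProduct, Matrix.map_apply, Pi.smul_apply, smul_eq_mul] at this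
    rw [← Finset.add_sum_erase _ _ (Finset.mem_univ i)] at this
    linear_combination -this
  have h2 : ‖μ - M i i‖ * ‖z i‖ ≤ ∑ j ∈ Finset.univ.erase i, M i j * (c * v j) := by
    rw [← norm_mul, h1]
    refine (norm_sum_le _ _).trans (Finset.sum_le_sum fun j hj => ?_)
    have h0 := hM i j (Finset.ne_of_mem_erase hj).symm
    rw [norm_mul, Complex.norm_real, Real.norm_of_nonneg h0]
    exact mul_le_mul_of_nonneg_left (hle j) h0
  have h3 := ht i
  simp only [Matrix.mulVec, dotProduct] at h3
  rw [← Finset.add_sum_erase _ _ (Finset.mem_univ i)] at h3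
  have h4 : ∑ j ∈ Finset.univ.erase i, M i j * (c * v j)
      = c * ∑ j ∈ Finset.univ.erase i, M i j * v j := by
    rw [Finset.mul_sum]; exact Finset.sum_congr rfl fun j _ => by ring
  rw [h4, hzi] at h2
  have h5 : ‖μ - M i i‖ * v i ≤ ∑ j ∈ Finset.univ.erase i, M i j * v j := by
    refine le_of_mul_le_mul_left ?_ hcpos
    linarith
  refine lt_of_mul_lt_mul_right ?_ (hv i).le
  linarith

lemma aux_hurwitz {m : Type*} [Fintype m] [DecidableEq m] (M : Matrix m m ℝ) (hM : IsMetzler M)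
    (v : m → ℝ) (hv : ∀ i, 0 < v i) (ht : ∀ i, (M *ᵥ v) i < 0) : IsHurwitz M := by
  intro μ hμ
  obtain ⟨i, hi⟩ := aux_eig M hM v hv 0 (by simpa using ht) μ hμ
  have := (Complex.re_le_norm (μ - M i i)).trans_lt hi
  simp at this
  linarith

section
attribute [local instance] Matrix.linftyOpNormedRing Matrix.linftyOpNormedAlgebra

lemma aux_spectralRadius {m : Type*} [Fintype m] [DecidableEq m] (S : Matrix m m ℂ)
    (h : ∀ μ ∈ spectrum ℂ S, ‖μ‖ < 1) : spectralRadius ℂ S < 1 := by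
  cases isEmpty_or_nonempty m
  · have : Subsingleton (Matrix m m ℂ) := inferInstance
    rw [spectrum.SpectralRadius.of_subsingleton]; simp
  · have : CompleteSpace (Matrix m m ℂ) := FiniteDimensional.complete ℂ _
    exact_mod_cast spectrum.spectralRadius_lt_of_forall_lt S (r := 1) fun μ hμ => by
      exact_mod_cast h μ hμ

lemma aux_spectralRadius_ne_top {m : Type*} [Fintype m] [DecidableEq m] (S : Matrix m m ℂ) :
    spectralRadius ℂ S ≠ ⊤ := by
  have : CompleteSpace (Matrix m m ℂ) := FiniteDimensional.complete ℂ _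
  refine ne_top_of_le_ne_top ?_ (spectrum.spectralRadius_le_pow_nnnorm_pow_one_div ℂ S 0)
  finiteness

lemma aux_vec {m : Type*} [Fintype m] [DecidableEq m] (S : Matrix m m ℝ)
    (hS : ∀ i j, 0 ≤ S i j) (h : spectralRadius ℂ (S.map (fun x => (x : ℂ))) < 1) :
    ∃ v : m → ℝ, (∀ i, 0 < v i) ∧ ∀ i, (S *ᵥ v) i < v i := by
  have : CompleteSpace (Matrix m m ℂ) := FiniteDimensional.complete ℂ _
  have hlim := spectrum.pow_nnnorm_pow_one_div_tendsto_nhds_spectralRadius (S.map (fun x => (x : ℂ)))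
  obtain ⟨k, hk, hk1⟩ := ((hlim.eventually (gt_mem_nhds h)).and (Filter.eventually_ge_atTop 1)).exists
  have hk' : ‖(S.map (fun x => (x : ℂ))) ^ k‖₊ < 1 := by
    by_contra! hc
    refine absurd hk (not_lt.2 ?_)
    exact ENNReal.one_le_rpow (by exact_mod_cast hc) (by positivity)
  have hnn : ∀ p : ℕ, ∀ i j, 0 ≤ (S ^ p) i j := by
    intro p
    induction p with
    | zero => intro i j; rw [pow_zero, Matrix.one_apply]; split_ifs <;> norm_num
    | succ p ih =>
      intro i j
      rw [pow_succ, Matrix.mul_apply]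
      exact Finset.sum_nonneg fun l _ => mul_nonneg (ih i l) (hS l j)
  have hmap : (S.map (fun x => (x : ℂ))) ^ k = (S ^ k).map (fun x => (x : ℂ)) :=
    (map_pow (Complex.ofRealHom.mapMatrix) S k).symm
  have hrow : ∀ i, ((S ^ k) *ᵥ (fun _ => (1 : ℝ))) i < 1 := by
    intro i
    rw [hmap, Matrix.linfty_opNNNorm_def] at hk'
    have h1 := (Finset.le_sup (f := fun i => ∑ j, ‖((S ^ k).map (fun x => (x : ℂ))) i j‖₊)
      (Finset.mem_univ i)).trans_lt hk'
    have h2 : (∑ j, ‖((S ^ k).map (fun x => (x : ℂ))) i j‖) < 1 := by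
      have := NNReal.coe_lt_coe.2 h1
      push_cast at this
      exact this
    refine lt_of_eq_of_lt ?_ h2
    simp only [Matrix.mulVec, dotProduct, mul_one, Matrix.map_apply, Complex.norm_real]
    exact Finset.sum_congr rfl fun j _ => (Real.norm_of_nonneg (hnn k i j)).symm
  refine ⟨(∑ p ∈ Finset.range k, S ^ p) *ᵥ (fun _ => (1 : ℝ)), fun i => ?_, fun i => ?_⟩
  · rw [Matrix.sum_mulVec, Finset.sum_apply]
    refine Finset.sum_pos' (fun p _ => ?_) ⟨0, Finset.mem_range.2 hk1, ?_⟩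
    · exact Finset.sum_nonneg fun j _ => mul_nonneg (hnn p i j) zero_le_one
    · simp
  · have hg := mul_neg_geom_sum S k
    have := congrFun (congrArg (fun X => X *ᵥ (fun _ => (1 : ℝ))) hg) i
    simp only [Matrix.sub_mulVec, ← Matrix.mulVec_mulVec, Matrix.one_mulVec, Pi.sub_apply] at this
    have := hrow i
    linarith
end

lemma aux_hurwitz_vec {m : Type*} [Fintype m] [DecidableEq m] (M : Matrix m m ℝ)
    (hM : IsMetzler M) (hH : IsHurwitz M) :
    ∃ v : m → ℝ, (∀ i, 0 < v i) ∧ ∀ i, (M *ᵥ v) i < 0 := by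
  have hfin : (spectrum ℂ (M.map (fun x => (x : ℂ)))).Finite := Matrix.finite_spectrum _
  have e1 : ∀ᶠ α : ℝ in Filter.atTop, ∀ μ ∈ spectrum ℂ (M.map (fun x => (x : ℂ))),
      ‖μ + α‖ < α := by
    rw [Filter.eventually_all_finite hfin]
    intro μ hμ
    have hre := hH μ hμ
    filter_upwards [Filter.eventually_gt_atTop (‖μ‖ ^ 2 / (-2 * μ.re)), Filter.eventually_gt_atTop 0]
      with α ha h0
    rw [div_lt_iff₀ (by linarith)] at ha
    refine lt_of_pow_lt_pow_left₀ 2 h0.le ?_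
    rw [Complex.sq_norm, Complex.normSq_apply] at ha ⊢
    simp
    nlinarith
  have e2 : ∀ᶠ α : ℝ in Filter.atTop, ∀ i, 0 ≤ α + M i i := by
    rw [Filter.eventually_all]
    intro i
    filter_upwards [Filter.eventually_ge_atTop (-M i i)] with α ha
    linarith
  obtain ⟨α, ⟨h1, h2⟩, hα⟩ := ((e1.and e2).and (Filter.eventually_gt_atTop 0)).exists
  obtain ⟨v, hv, hlt⟩ := aux_vec (1 + α⁻¹ • M) (by
      intro i j
      by_cases hij : i = j
      · subst hij
        have : (1 + α⁻¹ • M) i i = α⁻¹ * (α + M i i) := by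
          simp [mul_add, hα.ne']
        rw [this]
        exact mul_nonneg (inv_nonneg.2 hα.le) (h2 i)
      · simp [Matrix.one_apply_ne hij]
        exact mul_nonneg (inv_nonneg.2 hα.le) (hM i j hij))
    (aux_spectralRadius _ (by
      intro l hl
      obtain ⟨z, hz, he⟩ := (aux_mem_spectrum _ _).1 hl
      have hαc : (α : ℂ) ≠ 0 := by exact_mod_cast hα.ne'
      have hmap : (1 + α⁻¹ • M).map (fun x => (x : ℂ))
          = 1 + (α : ℂ)⁻¹ • M.map (fun x => (x : ℂ)) := by
        ext i j
        by_cases hij : i = j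
        · subst hij; simp
        · simp [Matrix.one_apply_ne hij]
      have hmem : (α : ℂ) * (l - 1) ∈ spectrum ℂ (M.map (fun x => (x : ℂ))) := by
        refine (aux_mem_spectrum _ _).2 ⟨z, hz, ?_⟩
        rw [hmap, Matrix.add_mulVec, Matrix.one_mulVec, Matrix.smul_mulVec] at he
        funext i
        have := congrFun he i
        simp only [Pi.add_apply, Pi.smul_apply, smul_eq_mul] at this ⊢
        field_simp at this
        linear_combination this
      have := h1 _ hmem
      have h3 : (α : ℂ) * (l - 1) + α = α * l := by ring
      rw [h3, norm_mul, Complex.norm_real, Real.norm_of_nonneg hα.le] at this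
      nlinarith))
  refine ⟨v, hv, fun i => ?_⟩
  have := hlt i
  rw [Matrix.add_mulVec, Matrix.one_mulVec, Matrix.smul_mulVec, Pi.add_apply, Pi.smul_apply,
    smul_eq_mul] at this
  have h4 : α⁻¹ * (M *ᵥ v) i < 0 := by linarith
  by_contra! hc
  exact absurd h4 (not_lt.2 (mul_nonneg (inv_nonneg.2 hα.le) hc))

lemma aux_specRad_vec {m : Type*} [Fintype m] [DecidableEq m] (S : Matrix m m ℝ)
    (hS : ∀ i j, 0 ≤ S i j) :
    specRad S < 1 ↔ ∃ v : m → ℝ, (∀ i, 0 < v i) ∧ ∀ i, (S *ᵥ v) i < v i := by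
  have hiff : specRad S < 1 ↔ spectralRadius ℂ (S.map (fun x => (x : ℂ))) < 1 := by
    unfold specRad
    rw [← ENNReal.toReal_one, ENNReal.toReal_lt_toReal (aux_spectralRadius_ne_top _) (by simp)]
  rw [hiff]
  refine ⟨aux_vec S hS, ?_⟩
  rintro ⟨v, hv, h⟩
  refine aux_spectralRadius _ fun μ hμ => ?_
  obtain ⟨i, hi⟩ := aux_eig S (fun i j _ => hS i j) v hv 1 (by simpa using h) μ hμ
  have h1 : ‖μ‖ ≤ ‖μ - S i i‖ + ‖(S i i : ℂ)‖ := by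
    simpa using norm_add_le (μ - S i i) (S i i : ℂ)
  rw [Complex.norm_real, Real.norm_of_nonneg (hS i i)] at h1
  linarith

lemma aux_mono {m : Type*} [Fintype m] [DecidableEq m] (S : Matrix m m ℝ)
    (hS : ∀ i j, 0 ≤ S i j) (v : m → ℝ) (hv : ∀ i, 0 < v i) (h : ∀ i, (S *ᵥ v) i < v i)
    (w : m → ℝ) (hw : ∀ i, 0 ≤ ((1 - S) *ᵥ w) i) : ∀ i, 0 ≤ w i := by
  intro k
  obtain ⟨i, -, hi⟩ := Finset.exists_min_image Finset.univ (fun i => w i / v i) ⟨k, Finset.mem_univ _⟩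
  set c := w i / v i with hc
  have hle : ∀ j, c * v j ≤ w j := fun j => (le_div_iff₀ (hv j)).1 (hi j (Finset.mem_univ _))
  have hwi : w i = c * v i := by rw [hc]; field_simp [(hv i).ne']
  have h1 := hw i
  rw [Matrix.sub_mulVec, Matrix.one_mulVec, Pi.sub_apply, hwi] at h1
  have h2 : c * (S *ᵥ v) i ≤ (S *ᵥ w) i := by
    simp only [Matrix.mulVec, dotProduct, Finset.mul_sum]
    refine Finset.sum_le_sum fun j _ => ?_
    have := mul_le_mul_of_nonneg_left (hle j) (hS i j)
    linarith
  have hcn : 0 ≤ c := by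
    by_contra! hneg
    have := mul_lt_mul_of_neg_left (h i) hneg
    linarith
  exact (mul_nonneg hcn (hv k).le).trans (hle k)

lemma aux_inv {m : Type*} [Fintype m] [DecidableEq m] (S : Matrix m m ℝ)
    (hS : ∀ i j, 0 ≤ S i j) (v : m → ℝ) (hv : ∀ i, 0 < v i) (h : ∀ i, (S *ᵥ v) i < v i) :
    IsUnit (1 - S).det ∧ ∀ w : m → ℝ, (∀ i, 0 ≤ w i) → ∀ i, 0 ≤ ((1 - S)⁻¹ *ᵥ w) i := by
  have hu : IsUnit (1 - S).det := by
    rw [isUnit_iff_ne_zero]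
    intro h0
    obtain ⟨w, hw, hw0⟩ := Matrix.exists_mulVec_eq_zero_iff.2 h0
    refine hw (funext fun i => le_antisymm ?_ ?_)
    · have := aux_mono S hS v hv h (-w) (by rw [Matrix.mulVec_neg, hw0]; simp) i
      simpa using this
    · exact aux_mono S hS v hv h w (by rw [hw0]; simp) i
  refine ⟨hu, fun w hw => aux_mono S hS v hv h _ ?_⟩
  rwa [Matrix.mulVec_mulVec, Matrix.mul_nonsing_inv _ hu, Matrix.one_mulVec]

lemma aux_block {n N : ℕ} (A₀ : Matrix (Fin n) (Fin n) ℝ)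
    (An R : Fin N → Matrix (Fin n) (Fin n) ℝ) (u : Fin n ⊕ Fin N × Fin n → ℝ) :
    (∀ k, (Matrix.fromBlocks A₀ rowOnes (colStack R) (blockRowRep An - 1) *ᵥ u) (Sum.inl k)
      = (A₀ *ᵥ (fun l => u (Sum.inl l))) k + ∑ i, u (Sum.inr (i, k))) ∧
    (∀ i k, (Matrix.fromBlocks A₀ rowOnes (colStack R) (blockRowRep An - 1) *ᵥ u) (Sum.inr (i, k))
      = (R i *ᵥ (fun l => u (Sum.inl l))) k + (An i *ᵥ (fun l => ∑ j, u (Sum.inr (j, l)))) k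
        - u (Sum.inr (i, k))) := by
  rw [Matrix.fromBlocks_mulVec]
  constructor
  · intro k
    simp only [Sum.elim_inl, Pi.add_apply]
    congr 1
    simp [Matrix.mulVec, dotProduct, rowOnes, Fintype.sum_prod_type]
  · intro i k
    simp only [Sum.elim_inr, Pi.add_apply, Matrix.sub_mulVec, Matrix.one_mulVec, Pi.sub_apply,
      Function.comp_apply, add_sub_assoc]
    have h : (blockRowRep An *ᵥ (u ∘ Sum.inr)) (i, k)
        = (An i *ᵥ (fun l => ∑ j, u (Sum.inr (j, l)))) k := by
      simp only [Matrix.mulVec, dotProduct, blockRowRep, Matrix.of_apply, Fintype.sum_prod_type,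
        Function.comp_apply, Finset.mul_sum]
      exact Finset.sum_comm
    rw [h]
    rfl

lemma aux_nn {m : Type*} [Fintype m] (S : Matrix m m ℝ) (hS : ∀ i j, 0 ≤ S i j)
    (w : m → ℝ) (hw : ∀ i, 0 ≤ w i) (i : m) : 0 ≤ (S *ᵥ w) i :=
  Finset.sum_nonneg fun j _ => mul_nonneg (hS i j) (hw j)

theorem stmt15 {n N : ℕ} (A₀ : Matrix (Fin n) (Fin n) ℝ)
    (An Ar : Fin N → Matrix (Fin n) (Fin n) ℝ)
    (hA₀ : IsMetzler A₀) (hAn : ∀ i, ∀ k l, 0 ≤ An i k l)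
    (hmix : ∀ i, ∀ k l, 0 ≤ (An i * A₀ + Ar i) k l) :
    IsHurwitz (Matrix.fromBlocks A₀ rowOnes
        (colStack (fun i => An i * A₀ + Ar i)) (blockRowRep An - 1)) ↔
      specRad (∑ i, An i) < 1 ∧
      IsHurwitz ((1 - ∑ i, An i)⁻¹ * (A₀ + ∑ i, Ar i)) := by
  set R : Fin N → Matrix (Fin n) (Fin n) ℝ := fun i => An i * A₀ + Ar i with hR
  set S := ∑ i, An i with hSdef
  have hS : ∀ k l, 0 ≤ S k l := fun k l => by
    rw [hSdef, Matrix.sum_apply]; exact Finset.sum_nonneg fun i _ => hAn i k l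
  have hRs : ∀ k l, 0 ≤ (∑ i, R i) k l := fun k l => by
    rw [Matrix.sum_apply]; exact Finset.sum_nonneg fun i _ => hmix i k l
  have hsplit : A₀ + ∑ i, Ar i = (1 - S) * A₀ + ∑ i, R i := by
    simp only [hR, Finset.sum_add_distrib, ← Finset.sum_mul, ← hSdef, sub_mul, one_mul]
    abel
  have hMet : IsMetzler (Matrix.fromBlocks A₀ rowOnes (colStack R) (blockRowRep An - 1)) := by
    rintro (i | ⟨i, k⟩) (j | ⟨j, l⟩) hij
    · exact hA₀ i j fun h => hij (by rw [h])
    · simp only [Matrix.fromBlocks_apply₁₂, rowOnes, Matrix.of_apply]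
      split_ifs <;> norm_num
    · exact hmix i k j
    · have hne : (i, k) ≠ (j, l) := fun h => hij (by rw [h])
      simp only [Matrix.fromBlocks_apply₂₂, Matrix.sub_apply, Matrix.one_apply_ne hne, sub_zero]
      exact hAn i k l
  -- the second matrix
  have hK : ∀ v : Fin n → ℝ, (∀ i, 0 < v i) → (∀ i, (S *ᵥ v) i < v i) →
      (1 - S)⁻¹ * (A₀ + ∑ i, Ar i) = A₀ + (1 - S)⁻¹ * ∑ i, R i ∧
      IsMetzler ((1 - S)⁻¹ * (A₀ + ∑ i, Ar i)) := by
    intro v hv hlt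
    obtain ⟨hu, hinv⟩ := aux_inv S hS v hv hlt
    have he : (1 - S)⁻¹ * (A₀ + ∑ i, Ar i) = A₀ + (1 - S)⁻¹ * ∑ i, R i := by
      rw [hsplit, mul_add, ← mul_assoc, Matrix.nonsing_inv_mul _ hu, one_mul]
    refine ⟨he, ?_⟩
    rw [he]
    intro i j hij
    refine add_nonneg (hA₀ i j hij) ?_
    exact hinv (fun k => (∑ i, R i) k j) (fun k => hRs k j) i
  constructor
  · intro hH
    obtain ⟨u, hu, hlt⟩ := aux_hurwitz_vec _ hMet hH
    obtain ⟨b1, b2⟩ := aux_block A₀ An R u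
    set x : Fin n → ℝ := fun l => u (Sum.inl l) with hx
    set s : Fin n → ℝ := fun l => ∑ j, u (Sum.inr (j, l)) with hs
    have hx0 : ∀ k, 0 < x k := fun k => hu _
    have hA : ∀ k, (A₀ *ᵥ x) k + s k < 0 := fun k => by rw [← b1]; exact hlt _
    have hB : ∀ i k, (R i *ᵥ x) k + (An i *ᵥ s) k < u (Sum.inr (i, k)) := fun i k => by
      have := hlt (Sum.inr (i, k)); rw [b2] at this; linarith
    have hsum : ∀ k, ((∑ i, R i) *ᵥ x) k + (S *ᵥ s) k
        = ∑ i, ((R i *ᵥ x) k + (An i *ᵥ s) k) := fun k => by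
      rw [hSdef, Matrix.sum_mulVec, Matrix.sum_mulVec, Finset.sum_apply, Finset.sum_apply,
        Finset.sum_add_distrib]
    have hle : ∀ k, ((∑ i, R i) *ᵥ x) k + (S *ᵥ s) k ≤ s k := fun k => by
      rw [hsum]; exact Finset.sum_le_sum fun i _ => (hB i k).le
    obtain ⟨v, hv, hvlt⟩ : ∃ v : Fin n → ℝ, (∀ i, 0 < v i) ∧ ∀ i, (S *ᵥ v) i < v i := by
      rcases Nat.eq_zero_or_pos N with rfl | hN
      · refine ⟨fun _ => 1, fun _ => one_pos, fun i => ?_⟩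
        simp [hSdef]
      · have : Nonempty (Fin N) := ⟨⟨0, hN⟩⟩
        refine ⟨s, fun k => Finset.sum_pos (fun i _ => hu _) Finset.univ_nonempty, fun k => ?_⟩
        have h1 : ((∑ i, R i) *ᵥ x) k + (S *ᵥ s) k < s k := by
          rw [hsum]
          exact Finset.sum_lt_sum_of_nonempty Finset.univ_nonempty fun i _ => hB i k
        have h2 := aux_nn _ hRs x (fun k => (hx0 k).le) k
        linarith
    refine ⟨(aux_specRad_vec S hS).2 ⟨v, hv, hvlt⟩, ?_⟩
    obtain ⟨he, hm⟩ := hK v hv hvlt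
    refine aux_hurwitz _ hm x hx0 fun k => ?_
    obtain ⟨hunit, hinv⟩ := aux_inv S hS v hv hvlt
    have h3 := hinv ((1 - S) *ᵥ s - (∑ i, R i) *ᵥ x) (fun k => by
      have := hle k
      simp only [Matrix.sub_mulVec, Matrix.one_mulVec, Pi.sub_apply]
      linarith) k
    rw [Matrix.mulVec_sub, Matrix.mulVec_mulVec, Matrix.nonsing_inv_mul _ hunit,
      Matrix.one_mulVec, Matrix.mulVec_mulVec, Pi.sub_apply] at h3
    rw [he, Matrix.add_mulVec, Pi.add_apply]
    have := hA k
    linarith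
  · rintro ⟨hrho, hH⟩
    obtain ⟨v, hv, hvlt⟩ := (aux_specRad_vec S hS).1 hrho
    obtain ⟨he, hm⟩ := hK v hv hvlt
    obtain ⟨x, hx, hxlt⟩ := aux_hurwitz_vec _ hm hH
    obtain ⟨hunit, hinv⟩ := aux_inv S hS v hv hvlt
    rw [he] at hxlt
    set o : Fin n → ℝ := (1 - S)⁻¹ *ᵥ (fun _ => (1 : ℝ)) with ho
    have hev : ∀ᶠ ε : ℝ in nhdsWithin 0 (Set.Ioi 0),
        ∀ k, ((A₀ + (1 - S)⁻¹ * ∑ i, R i) *ᵥ x) k + ε * o k < 0 := by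
      rw [Filter.eventually_all]
      intro k
      have hc : Continuous fun ε : ℝ =>
          ((A₀ + (1 - S)⁻¹ * ∑ i, R i) *ᵥ x) k + ε * o k := by fun_prop
      refine Filter.Eventually.filter_mono nhdsWithin_le_nhds ?_
      exact hc.continuousAt.eventually_lt continuousAt_const (by simpa using hxlt k)
    obtain ⟨ε, hε, hε0⟩ := (hev.and self_mem_nhdsWithin).exists
    have hε0 : 0 < ε := hε0
    set s : Fin n → ℝ := (1 - S)⁻¹ *ᵥ ((∑ i, R i) *ᵥ x + ε • (fun _ => (1 : ℝ))) with hs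
    have hs1 : ∀ k, s k = ((∑ i, R i) *ᵥ x) k + ε + (S *ᵥ s) k := by
      intro k
      have : (1 - S) *ᵥ s = (∑ i, R i) *ᵥ x + ε • (fun _ => (1 : ℝ)) := by
        rw [hs, Matrix.mulVec_mulVec, Matrix.mul_nonsing_inv _ hunit, Matrix.one_mulVec]
      have := congrFun this k
      simp only [Matrix.sub_mulVec, Matrix.one_mulVec, Pi.sub_apply, Pi.add_apply, Pi.smul_apply,
        smul_eq_mul, mul_one] at this
      linarith
    have hs0 : ∀ k, 0 ≤ s k := hinv _ fun k => by
      have := aux_nn _ hRs x (fun k => (hx k).le) k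
      simp only [Pi.add_apply, Pi.smul_apply, smul_eq_mul, mul_one]
      linarith
    have hs2 : ∀ k, (A₀ *ᵥ x) k + s k < 0 := by
      intro k
      have := hε k
      rw [hs, Matrix.mulVec_add, Matrix.mulVec_smul, ← ho, Matrix.mulVec_mulVec]
      rw [Matrix.add_mulVec] at this
      simp only [Pi.add_apply, Pi.smul_apply, smul_eq_mul] at this ⊢
      linarith
    set δ : ℝ := ε / (N + 1) with hδ
    have hδ0 : 0 < δ := by positivity
    have hδN : N * δ ≤ ε := by
      have : (N + 1) * δ = ε := by rw [hδ]; field_simp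
      linarith
    set u : Fin n ⊕ Fin N × Fin n → ℝ :=
      Sum.elim x (fun p => (R p.1 *ᵥ x) p.2 + (An p.1 *ᵥ s) p.2 + δ) with hu
    obtain ⟨b1, b2⟩ := aux_block A₀ An R u
    have hsum : ∀ k, ∑ i, u (Sum.inr (i, k)) ≤ s k := by
      intro k
      rw [hs1 k, hSdef, Matrix.sum_mulVec, Matrix.sum_mulVec, Finset.sum_apply, Finset.sum_apply]
      simp only [hu, Sum.elim_inr, Finset.sum_add_distrib, Finset.sum_const, Finset.card_univ,
        Fintype.card_fin, nsmul_eq_mul]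
      linarith
    refine aux_hurwitz _ hMet u ?_ ?_
    · rintro (k | ⟨i, k⟩)
      · exact hx k
      · have h1 := aux_nn _ (hmix i) x (fun k => (hx k).le) k
        have h2 := aux_nn _ (hAn i) s hs0 k
        have h1 : 0 ≤ (R i *ᵥ x) k := h1
        simp only [hu, Sum.elim_inr]
        linarith
    · rintro (k | ⟨i, k⟩)
      · rw [b1]
        have := hsum k
        have := hs2 k
        have hxx : (fun l => u (Sum.inl l)) = x := rfl
        rw [hxx]
        linarith
      · rw [b2]
        have hxx : (fun l => u (Sum.inl l)) = x := rfl
        rw [hxx]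
        have h1 := aux_nn _ (hAn i) (s - fun l => ∑ j, u (Sum.inr (j, l)))
          (fun k => sub_nonneg.2 (hsum k)) k
        rw [Matrix.mulVec_sub, Pi.sub_apply] at h1
        have h2 : u (Sum.inr (i, k)) = (R i *ᵥ x) k + (An i *ᵥ s) k + δ := rfl
        linarith
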